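/- arXiv:0903.5056 — 2 statements merged into one kernel-verified Lean document; each statement's English description precedes it below -/
import Mathlib

section
/- Let n ≥ 0 be an integer and let p, q ∈ ℝ[x,y] be real polynomials of total degree at most n, and define I(t) = ∬_{Δ(t)} (∂q/∂x − ∂p/∂y) dx dy for t ∈ (0, 1/64) (by Green's theorem this equals the Abelian integral ∮_{δ(t)} (p dx + q dy)). Then there exist real polynomials p₁, p₂, p₃ ∈ ℝ[t] with 4·deg pᵢ ≤ n for i = 1,2,3, such that for all t ∈ (0, 1/64): I(t) = p₁(t)·J₁(t) + p₂(t)·J₂(t) + p₃(t)·J₃(t). -/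
open MeasureTheory Set Filter

/-- The region bounded by the real oval of `{x^2 y (1-x-y) = t}` in the first quadrant. -/
def Δset (t : ℝ) : Set (ℝ × ℝ) :=
  {z : ℝ × ℝ | 0 < z.1 ∧ 0 < z.2 ∧ t ≤ z.1 ^ 2 * z.2 * (1 - z.1 - z.2)}

/-- The Abelian integral `I_{i,j}(t) = ∬_{Δ(t)} x^i y^j dx dy` (integer powers). -/
noncomputable def Iab (i j : ℤ) (t : ℝ) : ℝ :=
  ∫ z in Δset t, z.1 ^ i * z.2 ^ j

noncomputable def J1 (t : ℝ) : ℝ := Iab 0 0 t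
noncomputable def J2 (t : ℝ) : ℝ := Iab 2 0 t
noncomputable def J3 (t : ℝ) : ℝ := Iab 3 0 t

/-- The Abelian integral of the 1-form `p dx + q dy` over `δ(t)`, via Green's theorem. -/
noncomputable def abelInt (p q : MvPolynomial (Fin 2) ℝ) (t : ℝ) : ℝ :=
  ∫ z in Δset t,
    MvPolynomial.eval ![z.1, z.2]
      (MvPolynomial.pderiv (0 : Fin 2) q - MvPolynomial.pderiv (1 : Fin 2) p)

/-- The squared half-height of the section of `Δset t` at abscissa `x`. -/
noncomputable def sectionSq (t x : ℝ) : ℝ := ((1 - x) / 2) ^ 2 - t / x ^ 2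

/-- Half the width of the projection of `Δset t` to the first axis. -/
noncomputable def halfWidth (t : ℝ) : ℝ := √(1 / 4 - 2 * √t)

/-- The left endpoint of the projection of `Δset t` to the first axis. -/
noncomputable def lo (t : ℝ) : ℝ := 1 / 2 - halfWidth t

/-- The right endpoint of the projection of `Δset t` to the first axis. -/
noncomputable def hi (t : ℝ) : ℝ := 1 / 2 + halfWidth t

/-- The difference of the `k`-th powers of the endpoints of the section of `Δset t` at `x`. -/
noncomputable def endpointPow (k : ℕ) (t x : ℝ) : ℝ :=
  ((1 - x) / 2 + √(sectionSq t x)) ^ k - ((1 - x) / 2 - √(sectionSq t x)) ^ k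

/-- The one-dimensional moments to which integrals of monomials over `Δset t` reduce. -/
noncomputable def moment (j : ℤ) (k : ℕ) (t : ℝ) : ℝ :=
  ∫ x in lo t..hi t, x ^ j * endpointPow k t x

section Geometry

variable {t : ℝ}

lemma sqrt_bounds (ht : t ∈ Ioo (0 : ℝ) (1 / 64)) : 0 < √t ∧ √t < 1 / 8 := by
  refine ⟨Real.sqrt_pos.2 ht.1, ?_⟩
  rw [Real.sqrt_lt' (by norm_num)]
  linarith [ht.2]

lemma halfWidth_sq (ht : t ∈ Ioo (0 : ℝ) (1 / 64)) : halfWidth t ^ 2 = 1 / 4 - 2 * √t :=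
  Real.sq_sqrt (by linarith [(sqrt_bounds ht).2])

lemma halfWidth_pos (ht : t ∈ Ioo (0 : ℝ) (1 / 64)) : 0 < halfWidth t :=
  Real.sqrt_pos.2 (by linarith [(sqrt_bounds ht).2])

lemma halfWidth_lt (ht : t ∈ Ioo (0 : ℝ) (1 / 64)) : halfWidth t < 1 / 2 := by
  have h1 := halfWidth_sq ht
  have h2 := (sqrt_bounds ht).1
  nlinarith [halfWidth_pos ht]

lemma lo_pos (ht : t ∈ Ioo (0 : ℝ) (1 / 64)) : 0 < lo t := by
  have := halfWidth_lt ht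
  unfold lo; linarith

lemma hi_lt_one (ht : t ∈ Ioo (0 : ℝ) (1 / 64)) : hi t < 1 := by
  have := halfWidth_lt ht
  unfold hi; linarith

lemma lo_le_hi (ht : t ∈ Ioo (0 : ℝ) (1 / 64)) : lo t ≤ hi t := by
  have := halfWidth_pos ht
  unfold lo hi; linarith

lemma sectionSq_eq (ht : t ∈ Ioo (0 : ℝ) (1 / 64)) {x : ℝ} (hx : 0 < x) :
    sectionSq t x = (x - lo t) * (hi t - x) * (x * (1 - x) + 2 * √t) / (4 * x ^ 2) := by
  have h1 := halfWidth_sq ht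
  have h2 : √t ^ 2 = t := Real.sq_sqrt ht.1.le
  have h3 : (x - lo t) * (hi t - x) = x * (1 - x) - 2 * √t := by
    unfold lo hi; linear_combination h1
  rw [h3, sectionSq]
  field_simp
  linear_combination 16 * h2

lemma sectionSq_lo (ht : t ∈ Ioo (0 : ℝ) (1 / 64)) : sectionSq t (lo t) = 0 := by
  rw [sectionSq_eq ht (lo_pos ht)]; simp

lemma sectionSq_hi (ht : t ∈ Ioo (0 : ℝ) (1 / 64)) : sectionSq t (hi t) = 0 := by
  rw [sectionSq_eq ht ((lo_pos ht).trans_le (lo_le_hi ht))]; simp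

lemma sectionSq_pos (ht : t ∈ Ioo (0 : ℝ) (1 / 64)) {x : ℝ} (hx : x ∈ Ioo (lo t) (hi t)) :
    0 < sectionSq t x := by
  have h0 : 0 < x := (lo_pos ht).trans hx.1
  have h1 : x < 1 := hx.2.trans (hi_lt_one ht)
  have h2 := (sqrt_bounds ht).1
  rw [sectionSq_eq ht h0]
  have := sub_pos.2 hx.1
  have := sub_pos.2 hx.2
  have := sub_pos.2 h1
  positivity

lemma sectionSq_nonneg (ht : t ∈ Ioo (0 : ℝ) (1 / 64)) {x : ℝ} (hx : x ∈ Icc (lo t) (hi t)) :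
    0 ≤ sectionSq t x := by
  have h0 : 0 < x := (lo_pos ht).trans_le hx.1
  have h1 : x < 1 := hx.2.trans_lt (hi_lt_one ht)
  have h2 := (sqrt_bounds ht).1
  rw [sectionSq_eq ht h0]
  have := sub_nonneg.2 hx.1
  have := sub_nonneg.2 hx.2
  have := sub_pos.2 h1
  positivity

lemma mem_Icc_of_sectionSq_nonneg (ht : t ∈ Ioo (0 : ℝ) (1 / 64)) {x : ℝ} (h0 : 0 < x)
    (h1 : x < 1) (h : 0 ≤ sectionSq t x) : x ∈ Icc (lo t) (hi t) := by
  have h2 := (sqrt_bounds ht).1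
  have h3 := halfWidth_pos ht
  rw [sectionSq_eq ht h0] at h
  have h4 : 0 < x * (1 - x) + 2 * √t := by
    have := sub_pos.2 h1
    positivity
  have h5 : 0 ≤ (x - lo t) * (hi t - x) := by
    by_contra! hneg
    have : (x - lo t) * (hi t - x) * (x * (1 - x) + 2 * √t) / (4 * x ^ 2) < 0 :=
      div_neg_of_neg_of_pos (mul_neg_of_neg_of_pos hneg h4) (by positivity)
    linarith
  have h6 : lo t ≤ hi t := lo_le_hi ht
  constructor
  · by_contra! hlt
    nlinarith
  · by_contra! hlt
    nlinarith

lemma mem_Δset_iff (ht : t ∈ Ioo (0 : ℝ) (1 / 64)) (x y : ℝ) :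
    (x, y) ∈ Δset t ↔ x ∈ Icc (lo t) (hi t) ∧
      y ∈ Icc ((1 - x) / 2 - √(sectionSq t x)) ((1 - x) / 2 + √(sectionSq t x)) := by
  have key : ∀ {x : ℝ}, 0 < x →
      (t ≤ x ^ 2 * y * (1 - x - y) ↔ (y - (1 - x) / 2) ^ 2 ≤ sectionSq t x) := by
    intro x hx
    have hx2 : 0 < x ^ 2 := by positivity
    have h : (y - (1 - x) / 2) ^ 2 ≤ sectionSq t x ↔ t / x ^ 2 ≤ y * (1 - x - y) := by
      unfold sectionSq
      constructor <;> intro h <;> linarith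
    rw [h, div_le_iff₀ hx2]
    constructor <;> intro h <;> linarith
  constructor
  · rintro ⟨h0, hy, h⟩
    simp only at h0 hy h
    have h1 : x < 1 := by
      by_contra! hle
      have : x ^ 2 * y * (1 - x - y) ≤ 0 :=
        mul_nonpos_of_nonneg_of_nonpos (by positivity) (by linarith)
      linarith [ht.1]
    have h2 := (key h0).1 h
    have h3 := Real.abs_le_sqrt h2
    rw [abs_le] at h3
    exact ⟨mem_Icc_of_sectionSq_nonneg ht h0 h1 ((sq_nonneg _).trans h2),
      by linarith, by linarith⟩
  · rintro ⟨hx, hy⟩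
    have h0 : 0 < x := (lo_pos ht).trans_le hx.1
    have h1 : x < 1 := hx.2.trans_lt (hi_lt_one ht)
    have h2 : (y - (1 - x) / 2) ^ 2 ≤ sectionSq t x := by
      rw [← Real.sq_sqrt (sectionSq_nonneg ht hx), sq_le_sq, abs_of_nonneg (Real.sqrt_nonneg _),
        abs_le]
      exact ⟨by linarith [hy.1], by linarith [hy.2]⟩
    refine ⟨h0, ?_, (key h0).2 h2⟩
    have h3 : 0 < t / x ^ 2 := div_pos ht.1 (by positivity)
    have h4 : √(sectionSq t x) < (1 - x) / 2 := by
      rw [Real.sqrt_lt' (by linarith), sectionSq]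
      linarith
    simp only
    linarith [hy.1]

lemma isCompact_Δset (ht : t ∈ Ioo (0 : ℝ) (1 / 64)) : IsCompact (Δset t) := by
  have h : Δset t = (Icc (lo t) (hi t) ×ˢ Icc (0 : ℝ) 1) ∩
      {z : ℝ × ℝ | t ≤ z.1 ^ 2 * z.2 * (1 - z.1 - z.2)} := by
    ext ⟨x, y⟩
    constructor
    · intro h
      have hx := ((mem_Δset_iff ht x y).1 h).1
      refine ⟨⟨hx, h.2.1.le, ?_⟩, h.2.2⟩
      obtain ⟨h0, hy, hxy⟩ := h
      simp only at h0 hy hxy ⊢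
      by_contra! hle
      have : x ^ 2 * y * (1 - x - y) ≤ 0 :=
        mul_nonpos_of_nonneg_of_nonpos (by positivity) (by linarith)
      linarith [ht.1]
    · rintro ⟨⟨hx, hy⟩, h⟩
      refine ⟨(lo_pos ht).trans_le hx.1, lt_of_le_of_ne hy.1 ?_, h⟩
      rintro h0
      simp only [mem_ofPred_eq] at h h0
      rw [← h0] at h
      linarith [ht.1]
  rw [h]
  exact (isCompact_Icc.prod isCompact_Icc).inter_right
    (isClosed_le continuous_const (by fun_prop))

lemma integrableOn_monomial (ht : t ∈ Ioo (0 : ℝ) (1 / 64)) (i j : ℕ) :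
    IntegrableOn (fun z : ℝ × ℝ => z.1 ^ i * z.2 ^ j) (Δset t) :=
  ContinuousOn.integrableOn_compact (isCompact_Δset ht) (by fun_prop)

lemma setIntegral_monomial (ht : t ∈ Ioo (0 : ℝ) (1 / 64)) (i j : ℕ) :
    ∫ z in Δset t, z.1 ^ i * z.2 ^ j = (j + 1 : ℝ)⁻¹ * moment i (j + 1) t := by
  have hmeas : MeasurableSet (Δset t) := (isCompact_Δset ht).isClosed.measurableSet
  rw [← integral_indicator hmeas, Measure.volume_eq_prod, integral_prod _
    (by rw [← Measure.volume_eq_prod]; exact (integrableOn_monomial ht i j).integrable_indicator hmeas)]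
  have hinner : ∀ x : ℝ, ∫ y, (Δset t).indicator (fun z : ℝ × ℝ => z.1 ^ i * z.2 ^ j) (x, y) =
      (Icc (lo t) (hi t)).indicator
        (fun x => (j + 1 : ℝ)⁻¹ * (x ^ (i : ℤ) * endpointPow (j + 1) t x)) x := by
    intro x
    by_cases hx : x ∈ Icc (lo t) (hi t)
    · have h : ∀ y, (Δset t).indicator (fun z : ℝ × ℝ => z.1 ^ i * z.2 ^ j) (x, y) =
          (Icc ((1 - x) / 2 - √(sectionSq t x)) ((1 - x) / 2 + √(sectionSq t x))).indicator
            (fun y => x ^ i * y ^ j) y := by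
        intro y
        simp only [indicator, mem_Δset_iff ht, hx, true_and]
      simp_rw [h]
      rw [integral_indicator measurableSet_Icc, integral_Icc_eq_integral_Ioc,
        ← intervalIntegral.integral_of_le (by linarith [Real.sqrt_nonneg (sectionSq t x)]),
        intervalIntegral.integral_const_mul, integral_pow, indicator_of_mem hx, endpointPow,
        zpow_natCast]
      ring
    · have h : ∀ y, (Δset t).indicator (fun z : ℝ × ℝ => z.1 ^ i * z.2 ^ j) (x, y) = 0 := by
        intro y
        simp only [indicator, mem_Δset_iff ht, hx, false_and, if_false]
      simp [h, hx]
  simp_rw [hinner]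
  rw [integral_indicator measurableSet_Icc, integral_Icc_eq_integral_Ioc,
    ← intervalIntegral.integral_of_le (lo_le_hi ht), intervalIntegral.integral_const_mul, moment]

lemma continuousOn_zpow_Icc (ht : t ∈ Ioo (0 : ℝ) (1 / 64)) (j : ℤ) :
    ContinuousOn (fun x : ℝ => x ^ j) (Icc (lo t) (hi t)) :=
  continuousOn_id.zpow₀ j fun _ hx => Or.inl ((lo_pos ht).trans_le hx.1).ne'

lemma continuousOn_sectionSq (ht : t ∈ Ioo (0 : ℝ) (1 / 64)) :
    ContinuousOn (sectionSq t) (Icc (lo t) (hi t)) := by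
  unfold sectionSq
  refine ContinuousOn.sub (by fun_prop) (continuousOn_const.div (by fun_prop) fun x hx => ?_)
  exact (pow_pos ((lo_pos ht).trans_le hx.1) 2).ne'

lemma intervalIntegrable_moment (ht : t ∈ Ioo (0 : ℝ) (1 / 64)) (j : ℤ) (k : ℕ) :
    IntervalIntegrable (fun x => x ^ j * endpointPow k t x) volume (lo t) (hi t) := by
  apply ContinuousOn.intervalIntegrable_of_Icc (lo_le_hi ht)
  have := continuousOn_sectionSq ht
  unfold endpointPow
  exact (continuousOn_zpow_Icc ht j).mul (by fun_prop)

/-- The endpoints of a section are the roots of `y² - (1 - x) y + t x⁻²`. -/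
lemma moment_succ_succ (ht : t ∈ Ioo (0 : ℝ) (1 / 64)) (j : ℤ) (k : ℕ) :
    moment j (k + 2) t =
      moment j (k + 1) t - moment (j + 1) (k + 1) t - t * moment (j - 2) k t := by
  have i1 := intervalIntegrable_moment ht j (k + 1)
  have i2 := intervalIntegrable_moment ht (j + 1) (k + 1)
  have i3 := intervalIntegrable_moment ht (j - 2) k
  unfold moment
  rw [← intervalIntegral.integral_const_mul, ← intervalIntegral.integral_sub i1 i2,
    ← intervalIntegral.integral_sub (i1.sub i2) (i3.const_mul t)]
  apply intervalIntegral.integral_congr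
  rw [uIcc_of_le (lo_le_hi ht)]
  intro x hx
  have h0 : x ≠ 0 := ((lo_pos ht).trans_le hx.1).ne'
  have h1 := Real.sq_sqrt (sectionSq_nonneg ht hx)
  simp only [endpointPow]
  rw [zpow_add_one₀ h0, zpow_sub₀ h0]
  set s := √(sectionSq t x)
  have h2 : t = x ^ 2 * (((1 - x) / 2) ^ 2 - s ^ 2) := by
    rw [h1, sectionSq]; field_simp; ring
  have h3 : t * (x ^ j / x ^ (2 : ℤ)) = x ^ j * (((1 - x) / 2) ^ 2 - s ^ 2) := by
    rw [h2]
    have : x ^ (2 : ℤ) = x ^ 2 := by norm_cast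
    rw [this]; field_simp
  rw [← mul_assoc, h3]
  ring

lemma moment_zero (j : ℤ) : moment j 0 t = 0 := by
  simp [moment, endpointPow]

lemma endpointPow_one (x : ℝ) : endpointPow 1 t x = 2 * √(sectionSq t x) := by
  unfold endpointPow; ring

/-- Invariance of `Δset t` sections under `x ↦ 1 - x`, up to rescaling. -/
lemma moment_one_one (ht : t ∈ Ioo (0 : ℝ) (1 / 64)) : moment 1 1 t = 2 * moment 2 1 t := by
  have hrefl := intervalIntegral.integral_comp_sub_left (a := lo t) (b := hi t)
    (fun x => x ^ (2 : ℤ) * endpointPow 1 t x) 1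
  have e1 : 1 - hi t = lo t := by unfold lo hi; ring
  have e2 : 1 - lo t = hi t := by unfold lo hi; ring
  rw [e1, e2] at hrefl
  have hsum : moment 1 1 t - moment 2 1 t = moment 2 1 t := by
    conv_rhs => rw [moment, ← hrefl]
    rw [moment, moment, ← intervalIntegral.integral_sub (intervalIntegrable_moment ht 1 1)
      (intervalIntegrable_moment ht 2 1)]
    apply intervalIntegral.integral_congr
    rw [uIcc_of_le (lo_le_hi ht)]
    intro x hx
    have h0 : 0 < x := (lo_pos ht).trans_le hx.1
    have h1 : 0 < 1 - x := by linarith [hx.2, hi_lt_one ht]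
    have hs : ∀ z : ℝ, 0 < z → z * √(sectionSq t z) = √((z * (1 - z) / 2) ^ 2 - t) := by
      intro z hz
      rw [← Real.sqrt_sq hz.le, ← Real.sqrt_mul (sq_nonneg _), Real.sqrt_sq hz.le, sectionSq]
      congr 1
      field_simp
    have hsymm : (1 - x) * √(sectionSq t (1 - x)) = x * √(sectionSq t x) := by
      rw [hs x h0, hs _ h1]
      congr 1
      ring
    have z2 : ∀ z : ℝ, z ^ (2 : ℤ) = z ^ 2 := fun z => by norm_cast
    simp only [endpointPow_one, zpow_one, z2]
    linear_combination -2 * (1 - x) * hsymm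
  linarith

lemma moment_recurrence (ht : t ∈ Ioo (0 : ℝ) (1 / 64)) (k : ℤ) :
    (k + 3 : ℝ) * moment (k + 1) 1 t - (2 * k + 3) * moment k 1 t + k * moment (k - 1) 1 t =
      4 * (k - 3) * t * moment (k - 3) 1 t := by
  have i1 := (intervalIntegrable_moment ht (k + 1) 1).const_mul (k + 3 : ℝ)
  have i2 := (intervalIntegrable_moment ht k 1).const_mul (2 * k + 3 : ℝ)
  have i3 := (intervalIntegrable_moment ht (k - 1) 1).const_mul (k : ℝ)
  have i4 := (intervalIntegrable_moment ht (k - 3) 1).const_mul (4 * (k - 3) * t : ℝ)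
  have hI := ((i1.sub i2).add i3).sub i4
  have hderiv := intervalIntegral.integral_eq_sub_of_hasDerivAt_of_le (lo_le_hi ht)
    (f := fun x => 8 * (x ^ k * (sectionSq t x * √(sectionSq t x)))) ?_ ?_ hI
  · simp only [sectionSq_lo ht, sectionSq_hi ht, zero_mul, mul_zero, sub_zero] at hderiv
    rw [← sub_eq_zero, ← hderiv, intervalIntegral.integral_sub ((i1.sub i2).add i3) i4,
      intervalIntegral.integral_add (i1.sub i2) i3, intervalIntegral.integral_sub i1 i2]
    simp only [intervalIntegral.integral_const_mul, moment]
  · have h1 := continuousOn_sectionSq ht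
    have h2 := continuousOn_zpow_Icc ht k
    fun_prop
  · intro x hx
    have h0 : x ≠ 0 := ((lo_pos ht).trans hx.1).ne'
    have hW := sectionSq_pos ht hx
    have d0 : HasDerivAt (sectionSq t) (-(1 - x) / 2 + 2 * t / x ^ 3) x := by
      have d1 : HasDerivAt (fun x : ℝ => ((1 - x) / 2) ^ 2) (-(1 - x) / 2) x := by
        have := (((hasDerivAt_id x).const_sub 1).div_const 2).pow 2
        refine this.congr_deriv ?_
        simp; ring
      have d2 : HasDerivAt (fun x : ℝ => t / x ^ 2) (-(2 * t / x ^ 3)) x := by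
        have := (hasDerivAt_const x t).div (hasDerivAt_pow 2 x) (pow_ne_zero 2 h0)
        refine this.congr_deriv ?_
        field_simp; simp; ring
      have := d1.sub d2
      rw [sub_neg_eq_add] at this
      exact this
    have d3 := ((hasDerivAt_zpow k x (Or.inl h0)).mul
      (d0.mul (d0.sqrt hW.ne'))).const_mul (8 : ℝ)
    refine d3.congr_deriv ?_
    have hs : √(sectionSq t x) ≠ 0 := (Real.sqrt_pos.2 hW).ne'
    have hs2 := Real.mul_self_sqrt hW.le
    have hW' : sectionSq t x = ((1 - x) / 2) ^ 2 - t / x ^ 2 := rfl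
    simp only [Pi.mul_apply, endpointPow_one]
    set s := √(sectionSq t x)
    have hd : sectionSq t x * ((-(1 - x) / 2 + 2 * t / x ^ 3) / (2 * s)) =
        (-(1 - x) / 2 + 2 * t / x ^ 3) * s / 2 := by
      rw [← hs2]; field_simp
    rw [hd, hW']
    have z3 : x ^ (3 : ℤ) = x ^ 3 := by norm_cast
    rw [zpow_add_one₀ h0, zpow_sub_one₀ h0, zpow_sub₀ h0, z3]
    field_simp
    ring

end Geometry

/-- Functions that on `(0, 1/64)` are combinations of `J1`, `J2`, `J3` with polynomial
coefficients of degree at most `N / 4`. -/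
def petrovFiltration (N : ℕ) : Submodule ℝ (ℝ → ℝ) where
  carrier := {f | ∃ p₁ p₂ p₃ : Polynomial ℝ,
    4 * p₁.natDegree ≤ N ∧ 4 * p₂.natDegree ≤ N ∧ 4 * p₃.natDegree ≤ N ∧
    ∀ t ∈ Ioo (0 : ℝ) (1 / 64),
      f t = p₁.eval t * J1 t + p₂.eval t * J2 t + p₃.eval t * J3 t}
  zero_mem' := ⟨0, 0, 0, by simp, by simp, by simp, by simp⟩
  add_mem' := by
    rintro f g ⟨p₁, p₂, p₃, h₁, h₂, h₃, hf⟩ ⟨q₁, q₂, q₃, k₁, k₂, k₃, hg⟩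
    have e₁ := Polynomial.natDegree_add_le p₁ q₁
    have e₂ := Polynomial.natDegree_add_le p₂ q₂
    have e₃ := Polynomial.natDegree_add_le p₃ q₃
    refine ⟨p₁ + q₁, p₂ + q₂, p₃ + q₃, by omega, by omega, by omega, fun t ht => ?_⟩
    simp only [Pi.add_apply, hf t ht, hg t ht, Polynomial.eval_add]
    ring
  smul_mem' := by
    rintro c f ⟨p₁, p₂, p₃, h₁, h₂, h₃, hf⟩
    have e₁ := Polynomial.natDegree_C_mul_le c p₁
    have e₂ := Polynomial.natDegree_C_mul_le c p₂
    have e₃ := Polynomial.natDegree_C_mul_le c p₃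
    refine ⟨.C c * p₁, .C c * p₂, .C c * p₃, by omega, by omega, by omega, fun t ht => ?_⟩
    simp only [Pi.smul_apply, smul_eq_mul, hf t ht, Polynomial.eval_mul, Polynomial.eval_C]
    ring

lemma petrovFiltration_congr {N : ℕ} {f g : ℝ → ℝ} (hf : f ∈ petrovFiltration N)
    (h : ∀ t ∈ Ioo (0 : ℝ) (1 / 64), g t = f t) : g ∈ petrovFiltration N := by
  obtain ⟨p₁, p₂, p₃, h₁, h₂, h₃, hf⟩ := hf
  exact ⟨p₁, p₂, p₃, h₁, h₂, h₃, fun t ht => (h t ht).trans (hf t ht)⟩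

lemma petrovFiltration_mul_id {N : ℕ} {f : ℝ → ℝ} (hf : f ∈ petrovFiltration N) :
    (fun t => t * f t) ∈ petrovFiltration (N + 4) := by
  obtain ⟨p₁, p₂, p₃, h₁, h₂, h₃, hf⟩ := hf
  have e (p : Polynomial ℝ) : (Polynomial.X * p).natDegree ≤ 1 + p.natDegree :=
    Polynomial.natDegree_mul_le.trans (by simp)
  have e₁ := e p₁
  have e₂ := e p₂
  have e₃ := e p₃
  refine ⟨.X * p₁, .X * p₂, .X * p₃, by omega, by omega, by omega, fun t ht => ?_⟩
  simp only [hf t ht, Polynomial.eval_mul, Polynomial.eval_X]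
  ring

lemma Iab_natCast_zero {t : ℝ} (ht : t ∈ Ioo (0 : ℝ) (1 / 64)) (i : ℕ) :
    Iab i 0 t = moment i 1 t := by
  have := setIntegral_monomial ht i 0
  simpa [Iab] using this

lemma moment_zero_one_mem (N : ℕ) : moment 0 1 ∈ petrovFiltration N :=
  ⟨1, 0, 0, by simp, by simp, by simp, fun t ht => by
    simpa [J1] using (Iab_natCast_zero ht 0).symm⟩

lemma moment_two_one_mem (N : ℕ) : moment 2 1 ∈ petrovFiltration N :=
  ⟨0, 1, 0, by simp, by simp, by simp, fun t ht => by
    simpa [J2] using (Iab_natCast_zero ht 2).symm⟩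

lemma moment_three_one_mem (N : ℕ) : moment 3 1 ∈ petrovFiltration N :=
  ⟨0, 0, 1, by simp, by simp, by simp, fun t ht => by
    simpa [J3] using (Iab_natCast_zero ht 3).symm⟩

lemma moment_natCast_one_mem (j : ℕ) : ∀ N : ℕ, j + 1 ≤ N →
    moment j 1 ∈ petrovFiltration N := by
  induction j using Nat.strong_induction_on with
  | _ j ih =>
  intro N hN
  match j, ih, hN with
  | 0, _, _ => exact moment_zero_one_mem N
  | 1, _, _ =>
    exact petrovFiltration_congr (Submodule.smul_mem _ 2 (moment_two_one_mem N))
      fun t ht => by simpa using moment_one_one ht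
  | 2, _, _ => exact moment_two_one_mem N
  | 3, _, _ => exact moment_three_one_mem N
  | 4, _, _ =>
    refine petrovFiltration_congr (Submodule.sub_mem _
      (Submodule.smul_mem _ (3 / 2) (moment_three_one_mem N))
      (Submodule.smul_mem _ (1 / 2) (moment_two_one_mem N))) fun t ht => ?_
    have := moment_recurrence ht 3
    norm_num at this
    simp only [Pi.sub_apply, Pi.smul_apply, smul_eq_mul]
    push_cast
    linarith
  | j + 5, ih, hN =>
    obtain ⟨N, rfl⟩ : ∃ K, N = K + 4 := ⟨N - 4, by omega⟩
    have h1 := ih (j + 4) (by omega) (N + 4) (by omega)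
    have h2 := ih (j + 3) (by omega) (N + 4) (by omega)
    have h3 := petrovFiltration_mul_id (ih (j + 1) (by omega) N (by omega))
    refine petrovFiltration_congr (Submodule.smul_mem _ ((j + 7 : ℝ)⁻¹)
      (Submodule.add_mem _ (Submodule.sub_mem _ (Submodule.smul_mem _ (2 * j + 11 : ℝ) h1)
        (Submodule.smul_mem _ (j + 4 : ℝ) h2)) (Submodule.smul_mem _ (4 * (j + 1) : ℝ) h3)))
      fun t ht => ?_
    have := moment_recurrence ht (j + 4)
    have e1 : (j + 4 + 1 : ℤ) = (j + 5 : ℕ) := by push_cast; ring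
    have e2 : (j + 4 - 1 : ℤ) = (j + 3 : ℕ) := by push_cast; ring
    have e3 : (j + 4 - 3 : ℤ) = (j + 1 : ℕ) := by push_cast; ring
    have e4 : (j + 4 : ℤ) = (j + 4 : ℕ) := by push_cast; ring
    rw [e1, e2, e3, e4] at this
    simp only [Pi.sub_apply, Pi.add_apply, Pi.smul_apply, smul_eq_mul]
    rw [eq_inv_mul_iff_mul_eq₀ (by positivity)]
    push_cast at this ⊢
    linear_combination this

lemma pow_mul_moment_one_mem (m : ℕ) : ∀ (j : ℤ) (N : ℕ), -2 * m ≤ j → j + 4 * m + 1 ≤ N →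
    (fun t => t ^ m * moment j 1 t) ∈ petrovFiltration N := by
  induction m with
  | zero =>
    intro j N hj hN
    lift j to ℕ using by simpa using hj
    simpa using moment_natCast_one_mem j N (by simp at hN; omega)
  | succ m ih =>
    intro j N hj hN
    push_cast at hj hN
    by_cases h0 : 0 ≤ j
    · obtain ⟨N, rfl⟩ : ∃ K, N = K + 4 := ⟨N - 4, by omega⟩
      refine petrovFiltration_congr (petrovFiltration_mul_id (ih j N (by omega)
        (by push_cast at hN; omega))) fun t _ => ?_
      ring
    · have h1 := ih (j + 4) N (by omega) (by omega)
      have h2 := ih (j + 3) N (by omega) (by omega)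
      have h3 := ih (j + 2) N (by omega) (by omega)
      refine petrovFiltration_congr (Submodule.smul_mem _ ((4 * j : ℝ)⁻¹)
        (Submodule.add_mem _ (Submodule.sub_mem _ (Submodule.smul_mem _ (j + 6 : ℝ) h1)
          (Submodule.smul_mem _ (2 * j + 9 : ℝ) h2)) (Submodule.smul_mem _ (j + 3 : ℝ) h3)))
        fun t ht => ?_
      have hrec := moment_recurrence ht (j + 3)
      have e1 : j + 3 + 1 = j + 4 := by ring
      have e2 : j + 3 - 1 = j + 2 := by ring
      have e3 : j + 3 - 3 = j := by ring
      rw [e1, e2, e3] at hrec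
      have hj0 : (j : ℝ) ≠ 0 := by exact_mod_cast (by omega : j ≠ 0)
      simp only [Pi.sub_apply, Pi.add_apply, Pi.smul_apply, smul_eq_mul]
      rw [eq_inv_mul_iff_mul_eq₀ (by positivity)]
      push_cast at hrec
      linear_combination -t ^ m * hrec

lemma pow_mul_moment_mem (k : ℕ) : ∀ (m : ℕ) (j : ℤ) (N : ℕ), -2 * m ≤ j →
    j + k + 4 * m ≤ N → 1 ≤ k → (fun t => t ^ m * moment j k t) ∈ petrovFiltration N := by
  induction k using Nat.strong_induction_on with
  | _ k ih =>
  intro m j N hj hN hk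
  match k, ih, hN, hk with
  | 1, _, hN, _ => exact pow_mul_moment_one_mem m j N hj (by push_cast at hN; omega)
  | k + 2, ih, hN, _ =>
    push_cast at hN
    have h1 := ih (k + 1) (by omega) m j N hj (by push_cast; omega) (by omega)
    have h2 := ih (k + 1) (by omega) m (j + 1) N (by omega) (by push_cast; omega) (by omega)
    have h3 : (fun t => t ^ (m + 1) * moment (j - 2) k t) ∈ petrovFiltration N := by
      rcases Nat.eq_zero_or_pos k with rfl | hk
      · exact petrovFiltration_congr (Submodule.zero_mem _) fun t _ => by simp [moment_zero]
      · exact ih k (by omega) (m + 1) (j - 2) N (by push_cast; omega) (by push_cast; omega) hk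
    refine petrovFiltration_congr (Submodule.sub_mem _ (Submodule.sub_mem _ h1 h2) h3)
      fun t ht => ?_
    simp only [Pi.sub_apply, moment_succ_succ ht j k]
    ring

lemma setIntegral_monomial_mem (i j N : ℕ) (h : i + j + 1 ≤ N) :
    (fun t => ∫ z in Δset t, z.1 ^ i * z.2 ^ j) ∈ petrovFiltration N := by
  have hmem := pow_mul_moment_mem (j + 1) 0 i N (by simp) (by push_cast; omega) (by omega)
  refine petrovFiltration_congr (Submodule.smul_mem _ ((j + 1 : ℝ)⁻¹) hmem) fun t ht => ?_
  simpa using setIntegral_monomial ht i j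

lemma degree_succ_le_of_coeff_pderiv_ne_zero {σ : Type*} {i : σ} {p : MvPolynomial σ ℝ}
    {m : σ →₀ ℕ} (h : (MvPolynomial.pderiv i p).coeff m ≠ 0) :
    m.degree + 1 ≤ p.totalDegree := by
  rw [MvPolynomial.coeff_pderiv] at h
  have := MvPolynomial.le_totalDegree (MvPolynomial.mem_support_iff.2 (left_ne_zero_of_mul h))
  change Finsupp.degree _ ≤ _ at this
  simpa using this

/-- Lemma 2.3: every Abelian integral of a 1-form of degree `≤ n`
decomposes as `p₁ J₁ + p₂ J₂ + p₃ J₃` with `deg pᵢ ≤ n/4`. -/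
theorem petrov_module_decomposition (n : ℕ) (p q : MvPolynomial (Fin 2) ℝ)
    (hp : p.totalDegree ≤ n) (hq : q.totalDegree ≤ n) :
    ∃ p₁ p₂ p₃ : Polynomial ℝ,
      4 * p₁.natDegree ≤ n ∧ 4 * p₂.natDegree ≤ n ∧ 4 * p₃.natDegree ≤ n ∧
      ∀ t ∈ Set.Ioo (0 : ℝ) (1 / 64),
        abelInt p q t = p₁.eval t * J1 t + p₂.eval t * J2 t + p₃.eval t * J3 t := by
  set r := MvPolynomial.pderiv (0 : Fin 2) q - MvPolynomial.pderiv (1 : Fin 2) p with hr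
  have hdeg : ∀ m ∈ r.support, m 0 + m 1 + 1 ≤ n := by
    intro m hm
    have hm' : m.degree + 1 ≤ n := by
      rw [MvPolynomial.mem_support_iff, hr, MvPolynomial.coeff_sub] at hm
      by_cases h : (MvPolynomial.pderiv (0 : Fin 2) q).coeff m = 0
      · rw [h, zero_sub, neg_ne_zero] at hm
        exact (degree_succ_le_of_coeff_pderiv_ne_zero hm).trans hp
      · exact (degree_succ_le_of_coeff_pderiv_ne_zero h).trans hq
    simpa [Finsupp.degree_eq_sum] using hm'
  have hmem : (∑ m ∈ r.support, r.coeff m •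
      fun t => ∫ z in Δset t, z.1 ^ m 0 * z.2 ^ m 1) ∈ petrovFiltration n :=
    Submodule.sum_mem _ fun m hm =>
      Submodule.smul_mem _ _ (setIntegral_monomial_mem (m 0) (m 1) n (hdeg m hm))
  refine petrovFiltration_congr hmem fun t ht => ?_
  simp only [abelInt, ← hr, MvPolynomial.eval_eq', Fin.prod_univ_two, Matrix.cons_val_zero,
    Matrix.cons_val_one, Finset.sum_apply, Pi.smul_apply, smul_eq_mul]
  rw [integral_finsetSum _ fun m _ => (integrableOn_monomial ht (m 0) (m 1)).const_mul _]
  simp only [integral_const_mul]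
end

section
/- The functions J₁, J₂, J₃ satisfy the Picard–Fuchs system J = d/dt((A + tB)J) on (0, 1/64), where A is the 3×3 matrix with rows (0, −1/12, 1/12), (0, −1/56, 1/56), (0, −5/504, 5/504) and B is the 3×3 matrix with rows (2/3, 0, 0), (0, 4/7, 0), (0, 2/21, 4/9). Explicitly, for every t ∈ (0, 1/64): (i) the function s ↦ (2/3)s·J₁(s) − (1/12)·J₂(s) + (1/12)·J₃(s) is differentiable at t with derivative J₁(t); (ii) the function s ↦ ((4/7)s − 1/56)·J₂(s) + (1/56)·J₃(s) is differentiable at t with derivative J₂(t); (iii) the function s ↦ ((2/21)s − 5/504)·J₂(s) + ((4/9)s + 5/504)·J₃(s) is differentiable at t with derivative J₃(t). -/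
open MeasureTheory Set Filter

/-- The moments `∫₀¹ wᵏ √(w² - 4s) dx` with `w = x (1 - x)`. -/
noncomputable def sqrtMoment (k : ℤ) (s : ℝ) : ℝ :=
  ∫ x in (0 : ℝ)..1, (x * (1 - x)) ^ k * √((x * (1 - x)) ^ 2 - 4 * s)

/-- With the convention `√v = 0` for `v < 0`, `v √v` is differentiable everywhere. -/
lemma hasDerivAt_mul_sqrt (v : ℝ) : HasDerivAt (fun v : ℝ => v * √v) (3 / 2 * √v) v := by
  rcases lt_trichotomy v 0 with h | rfl | h
  · rw [Real.sqrt_eq_zero_of_nonpos h.le, mul_zero]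
    refine (hasDerivAt_const v (0 : ℝ)).congr_of_eventuallyEq ?_
    filter_upwards [Iio_mem_nhds h] with y hy
    rw [Real.sqrt_eq_zero_of_nonpos (le_of_lt hy), mul_zero]
  · rw [hasDerivAt_iff_tendsto_slope_zero]
    have h : Tendsto (fun y : ℝ => √y) (nhdsWithin 0 {0}ᶜ) (nhds (√0)) :=
      (Real.continuous_sqrt.tendsto 0).mono_left nhdsWithin_le_nhds
    simp only [Real.sqrt_zero, mul_zero, zero_add, sub_zero] at h ⊢
    refine h.congr' ?_
    filter_upwards [self_mem_nhdsWithin] with y hy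
    have : y ≠ 0 := hy
    simp [this]
  · have := (hasDerivAt_id v).mul (Real.hasDerivAt_sqrt h.ne')
    refine this.congr_deriv ?_
    have h1 := Real.sqrt_pos.2 h
    have h2 := Real.mul_self_sqrt h.le
    simp only [id]
    field_simp
    nlinarith

lemma mul_one_sub_mem_Icc {x : ℝ} (hx : x ∈ Icc (0 : ℝ) 1) : x * (1 - x) ∈ Icc (0 : ℝ) 1 :=
  ⟨mul_nonneg hx.1 (by linarith [hx.2]), by nlinarith [hx.1, hx.2]⟩

lemma sqrt_sq_sub_le {w s : ℝ} (hw : 0 ≤ w) (hs : 0 ≤ s) : √(w ^ 2 - 4 * s) ≤ w :=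
  Real.sqrt_le_iff.2 ⟨hw, by linarith⟩

lemma abs_zpow_mul_sqrt_le {k : ℤ} (hk : -1 ≤ k) {s x : ℝ} (hs : 0 ≤ s)
    (hx : x ∈ Icc (0 : ℝ) 1) :
    |(x * (1 - x)) ^ k * √((x * (1 - x)) ^ 2 - 4 * s)| ≤ 1 := by
  obtain ⟨h0, h1⟩ := mul_one_sub_mem_Icc hx
  generalize x * (1 - x) = w at h0 h1
  rw [abs_of_nonneg (by positivity)]
  refine (mul_le_mul_of_nonneg_left (sqrt_sq_sub_le h0 hs) (by positivity)).trans ?_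
  rcases h0.eq_or_lt with rfl | h
  · simp
  · rw [← zpow_add_one₀ h.ne']
    lift k + 1 to ℕ using by omega with n
    rw [zpow_natCast]
    exact pow_le_one₀ h0 h1

/-- A measurable function bounded on `[0, 1]` is interval integrable there. -/
lemma intervalIntegrable_of_abs_le {f : ℝ → ℝ} (hf : Measurable f) {C : ℝ}
    (h : ∀ x ∈ Icc (0 : ℝ) 1, |f x| ≤ C) : IntervalIntegrable f volume 0 1 := by
  refine (intervalIntegrable_const (c := C)).mono_fun' hf.aestronglyMeasurable ?_
  refine (ae_restrict_iff' measurableSet_uIoc).2 (.of_forall fun x hx => ?_)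
  rw [uIoc_of_le zero_le_one] at hx
  exact h x (Ioc_subset_Icc_self hx)

lemma intervalIntegrable_zpow_mul_sqrt {k : ℤ} (hk : -1 ≤ k) {s : ℝ} (hs : 0 ≤ s) :
    IntervalIntegrable (fun x : ℝ => (x * (1 - x)) ^ k * √((x * (1 - x)) ^ 2 - 4 * s))
      volume 0 1 :=
  intervalIntegrable_of_abs_le (by fun_prop) fun _ hx => abs_zpow_mul_sqrt_le hk hs hx

lemma integral_zpow_mul_sub_mul_sqrt {k : ℤ} (hk : -1 ≤ k) {s : ℝ} (hs : 0 ≤ s) :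
    ∫ x in (0 : ℝ)..1, (x * (1 - x)) ^ k *
        (((x * (1 - x)) ^ 2 - 4 * s) * √((x * (1 - x)) ^ 2 - 4 * s)) =
      sqrtMoment (k + 2) s - 4 * s * sqrtMoment k s := by
  unfold sqrtMoment
  rw [← intervalIntegral.integral_const_mul, ← intervalIntegral.integral_sub
    (intervalIntegrable_zpow_mul_sqrt (by omega) hs)
    ((intervalIntegrable_zpow_mul_sqrt hk hs).const_mul _)]
  congr 1 with x
  have h : (x * (1 - x)) ^ (k + 2) = (x * (1 - x)) ^ k * (x * (1 - x)) ^ 2 := by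
    rcases eq_or_ne (x * (1 - x)) 0 with h | h
    · rw [h, zero_zpow _ (by omega)]; simp
    · rw [zpow_add₀ h]; norm_cast
  rw [h]
  ring

lemma hasDerivAt_sqrtMoment_sub {k : ℤ} (hk : -1 ≤ k) {t : ℝ} (ht : 0 < t) :
    HasDerivAt (fun s => sqrtMoment (k + 2) s - 4 * s * sqrtMoment k s)
      (-6 * sqrtMoment k t) t := by
  have key := (intervalIntegral.hasDerivAt_integral_of_dominated_loc_of_deriv_le
    (μ := volume) (a := (0 : ℝ)) (b := 1) (x₀ := t) (bound := fun _ => 6) (s := Ioi 0)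
    (F := fun s x => (x * (1 - x)) ^ k *
        (((x * (1 - x)) ^ 2 - 4 * s) * √((x * (1 - x)) ^ 2 - 4 * s)))
    (F' := fun s x => -6 * ((x * (1 - x)) ^ k * √((x * (1 - x)) ^ 2 - 4 * s)))
    (Ioi_mem_nhds ht)
    (.of_forall fun s => (Measurable.aestronglyMeasurable (by fun_prop)))
    ?_ (Measurable.aestronglyMeasurable (by fun_prop)) ?_ intervalIntegrable_const ?_).2
  · rw [intervalIntegral.integral_const_mul] at key
    refine key.congr_of_eventuallyEq ?_
    filter_upwards [Ioi_mem_nhds ht] with s hs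
    exact (integral_zpow_mul_sub_mul_sqrt hk (le_of_lt hs)).symm
  · refine intervalIntegrable_of_abs_le (by fun_prop) (C := 1 + 4 * t) fun x hx => ?_
    have h1 := abs_zpow_mul_sqrt_le hk ht.le hx
    obtain ⟨h2, h3⟩ := mul_one_sub_mem_Icc hx
    rw [mul_left_comm, abs_mul]
    have h4 : |(x * (1 - x)) ^ 2 - 4 * t| ≤ 1 + 4 * t := abs_le.2 ⟨by nlinarith, by nlinarith⟩
    simpa using mul_le_mul h4 h1 (abs_nonneg _) (by positivity)
  · refine .of_forall fun x hx s hs => ?_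
    rw [uIoc_of_le zero_le_one] at hx
    have h := abs_zpow_mul_sqrt_le hk (le_of_lt hs) (Ioc_subset_Icc_self hx)
    rw [norm_mul, Real.norm_eq_abs, Real.norm_eq_abs, abs_neg, abs_of_pos (by norm_num)]
    linarith
  · refine .of_forall fun x _ s _ => ?_
    have h : HasDerivAt (fun s => (x * (1 - x)) ^ 2 - 4 * s) (-4) s := by
      simpa using ((hasDerivAt_id s).const_mul 4).const_sub ((x * (1 - x)) ^ 2)
    refine (((hasDerivAt_mul_sqrt _).comp s h).const_mul _).congr_deriv ?_
    ring

/-- The derivative in `x` of `v √v`, `v = (x (1 - x))² - 4 s`. -/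
lemma hasDerivAt_sub_mul_sqrt (s x : ℝ) :
    HasDerivAt (fun x : ℝ => ((x * (1 - x)) ^ 2 - 4 * s) * √((x * (1 - x)) ^ 2 - 4 * s))
      (3 * (x * (1 - x)) * (1 - 2 * x) * √((x * (1 - x)) ^ 2 - 4 * s)) x := by
  have hw : HasDerivAt (fun x : ℝ => x * (1 - x)) (1 - 2 * x) x := by
    refine ((hasDerivAt_id x).mul ((hasDerivAt_id x).const_sub 1)).congr_deriv ?_
    simp; ring
  refine ((hasDerivAt_mul_sqrt _).comp x ((hw.pow 2).sub_const (4 * s))).congr_deriv ?_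
  simp only [Pi.pow_apply]
  push_cast
  ring

lemma integral_eq_zero_of_hasDerivAt_mul {p f' : ℝ → ℝ} {s : ℝ} (hs : 0 ≤ s)
    (hf : ∀ x, HasDerivAt
      (fun x => p x * (((x * (1 - x)) ^ 2 - 4 * s) * √((x * (1 - x)) ^ 2 - 4 * s))) (f' x) x)
    (hc : Continuous f') : ∫ x in (0 : ℝ)..1, f' x = 0 := by
  rw [intervalIntegral.integral_eq_sub_of_hasDerivAt (fun x _ => hf x) (hc.intervalIntegrable _ _)]
  have : √(-(4 * s)) = 0 := Real.sqrt_eq_zero_of_nonpos (by linarith)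
  simp [this]

lemma sqrtMoment_relation_two {s : ℝ} (hs : 0 ≤ s) :
    7 * sqrtMoment 2 s - 3 / 2 * sqrtMoment 1 s - 4 * s * sqrtMoment 0 s = 0 := by
  have i0 := intervalIntegrable_zpow_mul_sqrt (k := 0) (by norm_num) hs
  have i1 := intervalIntegrable_zpow_mul_sqrt (k := 1) (by norm_num) hs
  have i2 := intervalIntegrable_zpow_mul_sqrt (k := 2) (by norm_num) hs
  unfold sqrtMoment
  simp only [← intervalIntegral.integral_const_mul]
  rw [← intervalIntegral.integral_sub (i2.const_mul _) (i1.const_mul _),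
    ← intervalIntegral.integral_sub ((i2.const_mul _).sub (i1.const_mul _)) (i0.const_mul _)]
  refine integral_eq_zero_of_hasDerivAt_mul (p := fun x => x - 1 / 2) hs (fun x => ?_) ?_
  · refine (((hasDerivAt_id x).sub_const (1 / 2)).mul
      (hasDerivAt_sub_mul_sqrt s x)).congr_deriv ?_
    simp only [id, zpow_ofNat]
    ring
  · simp only [zpow_ofNat]
    fun_prop

lemma sqrtMoment_relation_three {s : ℝ} (hs : 0 ≤ s) :
    9 * sqrtMoment 3 s - 2 * sqrtMoment 2 s - 12 * s * sqrtMoment 1 s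
      + 2 * s * sqrtMoment 0 s = 0 := by
  have i0 := intervalIntegrable_zpow_mul_sqrt (k := 0) (by norm_num) hs
  have i1 := intervalIntegrable_zpow_mul_sqrt (k := 1) (by norm_num) hs
  have i2 := intervalIntegrable_zpow_mul_sqrt (k := 2) (by norm_num) hs
  have i3 := intervalIntegrable_zpow_mul_sqrt (k := 3) (by norm_num) hs
  unfold sqrtMoment
  simp only [← intervalIntegral.integral_const_mul]
  rw [← intervalIntegral.integral_sub (i3.const_mul _) (i2.const_mul _),
    ← intervalIntegral.integral_sub ((i3.const_mul _).sub (i2.const_mul _)) (i1.const_mul _),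
    ← intervalIntegral.integral_add (((i3.const_mul _).sub (i2.const_mul _)).sub
      (i1.const_mul _)) (i0.const_mul _)]
  refine integral_eq_zero_of_hasDerivAt_mul (p := fun x => (x - 1 / 2) * (x * (1 - x))) hs
    (fun x => ?_) ?_
  · refine ((((hasDerivAt_id x).sub_const (1 / 2)).mul ((hasDerivAt_id x).mul
      ((hasDerivAt_id x).const_sub 1))).mul (hasDerivAt_sub_mul_sqrt s x)).congr_deriv ?_
    simp only [id, zpow_ofNat, Pi.mul_apply]
    ring
  · simp only [zpow_ofNat]
    fun_prop

lemma measurableSet_Δset (s : ℝ) : MeasurableSet (Δset s) := by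
  refine (measurableSet_lt measurable_const measurable_fst).inter
    ((measurableSet_lt measurable_const measurable_snd).inter
      (measurableSet_le (f := fun _ => s) measurable_const
        (g := fun z : ℝ × ℝ => z.1 ^ 2 * z.2 * (1 - z.1 - z.2)) (by fun_prop)))

lemma mem_Ioo_of_mem_Δset {s : ℝ} (hs : 0 < s) {z : ℝ × ℝ} (hz : z ∈ Δset s) :
    z.1 ∈ Ioo (0 : ℝ) 1 ∧ z.2 ∈ Ioo (0 : ℝ) 1 := by
  obtain ⟨h1, h2, h3⟩ := hz
  have h : 0 < 1 - z.1 - z.2 := pos_of_mul_pos_right (hs.trans_le h3) (by positivity)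
  exact ⟨⟨h1, by linarith⟩, h2, by linarith⟩

lemma volume_real_slice_Δset {s x : ℝ} (hs : 0 < s) (hx : x ∈ Ioc (0 : ℝ) 1) :
    volume.real {y | (x, y) ∈ Δset s} = √((x * (1 - x)) ^ 2 - 4 * s) / x := by
  obtain ⟨hx0, hx1⟩ := hx
  have key (y : ℝ) : (x, y) ∈ Δset s ↔
      (x * (2 * y - (1 - x))) ^ 2 ≤ (x * (1 - x)) ^ 2 - 4 * s := by
    constructor
    · rintro ⟨-, -, h⟩
      dsimp only at h
      nlinarith
    · intro h
      have h' : s ≤ x ^ 2 * (y * (1 - x - y)) := by nlinarith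
      have h2 : 0 < y * (1 - x - y) := pos_of_mul_pos_right (hs.trans_le h') (by positivity)
      refine ⟨hx0, ?_, by dsimp only; linarith⟩
      dsimp only
      by_contra! hy
      nlinarith [mul_nonneg (neg_nonneg.2 hy) (by linarith : 0 ≤ 1 - x - y)]
  rcases lt_or_ge ((x * (1 - x)) ^ 2 - 4 * s) 0 with hv | hv
  · have : {y | (x, y) ∈ Δset s} = ∅ := by
      ext y
      simp only [mem_ofPred_eq, key, mem_empty_iff_false, iff_false, not_le]
      exact hv.trans_le (sq_nonneg _)
    rw [this, Real.sqrt_eq_zero_of_nonpos hv.le]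
    simp
  · set r := √((x * (1 - x)) ^ 2 - 4 * s) / x with hr
    have hr0 : 0 ≤ r := by positivity
    have : {y | (x, y) ∈ Δset s} = Icc ((1 - x) / 2 - r / 2) ((1 - x) / 2 + r / 2) := by
      ext y
      have h : √((x * (1 - x)) ^ 2 - 4 * s) = x * r := by rw [hr]; field_simp
      rw [mem_ofPred_eq, key, ← Real.sqrt_le_sqrt_iff hv, Real.sqrt_sq_eq_abs, h, abs_mul,
        abs_of_pos hx0, mul_le_mul_iff_right₀ hx0, abs_le, mem_Icc]
      constructor <;> rintro ⟨h1, h2⟩ <;> constructor <;> linarith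
    rw [this, Real.volume_real_Icc_of_le (by linarith)]
    ring

lemma Iab_natCast_zero_s14 (n : ℕ) {s : ℝ} (hs : 0 < s) :
    Iab n 0 s = ∫ x in (0 : ℝ)..1, x ^ n * (√((x * (1 - x)) ^ 2 - 4 * s) / x) := by
  have hint : Integrable ((Δset s).indicator fun z : ℝ × ℝ => z.1 ^ n) := by
    rw [integrable_indicator_iff (measurableSet_Δset s)]
    have hsub : Δset s ⊆ Icc (0 : ℝ) 1 ×ˢ Icc (0 : ℝ) 1 := fun z hz =>
      ⟨Ioo_subset_Icc_self (mem_Ioo_of_mem_Δset hs hz).1,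
        Ioo_subset_Icc_self (mem_Ioo_of_mem_Δset hs hz).2⟩
    exact (ContinuousOn.integrableOn_compact (isCompact_Icc.prod isCompact_Icc)
      (by fun_prop)).mono_set hsub
  unfold Iab
  simp only [zpow_natCast, zpow_zero, mul_one]
  rw [← integral_indicator (measurableSet_Δset s), Measure.volume_eq_prod, integral_prod _ hint,
    intervalIntegral.integral_of_le zero_le_one, ← integral_indicator measurableSet_Ioc]
  congr 1 with x
  by_cases hx : x ∈ Ioc (0 : ℝ) 1
  · rw [indicator_of_mem hx, ← volume_real_slice_Δset hs hx, mul_comm, ← smul_eq_mul]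
    exact integral_indicator_const (x ^ n) (measurable_prodMk_left (measurableSet_Δset s))
  · rw [indicator_of_notMem hx]
    refine integral_eq_zero_of_ae (.of_forall fun y => indicator_of_notMem (fun h => hx ?_) _)
    exact Ioo_subset_Ioc_self (mem_Ioo_of_mem_Δset hs h).1

/-- Averaging over the reflection `x ↦ 1 - x`. -/
lemma integral_eq_half_add_reflect {f : ℝ → ℝ} (hf : IntervalIntegrable f volume 0 1) :
    ∫ x in (0 : ℝ)..1, f x = 1 / 2 * ∫ x in (0 : ℝ)..1, (f x + f (1 - x)) := by
  have hf' : IntervalIntegrable (fun x => f (1 - x)) volume 0 1 := by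
    simpa using (hf.comp_sub_left 1).symm
  rw [intervalIntegral.integral_add hf hf', intervalIntegral.integral_comp_sub_left]
  norm_num
  ring

lemma Iab_natCast_zero_eq_half (n : ℕ) {s : ℝ} (hs : 0 < s) :
    Iab n 0 s = 1 / 2 * ∫ x in (0 : ℝ)..1,
      (x ^ n / x + (1 - x) ^ n / (1 - x)) * √((x * (1 - x)) ^ 2 - 4 * s) := by
  rw [Iab_natCast_zero_s14 n hs, integral_eq_half_add_reflect]
  · congr 2 with x
    rw [show (1 - x) * (1 - (1 - x)) = x * (1 - x) by ring]
    ring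
  · refine intervalIntegrable_of_abs_le (by fun_prop) (C := 1) fun x hx => ?_
    obtain ⟨h0, h1⟩ := hx
    have h2 : √((x * (1 - x)) ^ 2 - 4 * s) ≤ x :=
      (sqrt_sq_sub_le (mul_one_sub_mem_Icc ⟨h0, h1⟩).1 hs.le).trans (by nlinarith)
    rw [abs_of_nonneg (by positivity)]
    exact mul_le_one₀ (pow_le_one₀ h0 h1) (by positivity) (div_le_one_of_le₀ h2 h0)

lemma J1_eq_sqrtMoment {s : ℝ} (hs : 0 < s) : J1 s = 1 / 2 * sqrtMoment (-1) s := by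
  refine (Iab_natCast_zero_eq_half 0 hs).trans ?_
  unfold sqrtMoment
  congr 1
  refine intervalIntegral.integral_congr_ae ?_
  filter_upwards [compl_mem_ae_iff.2 (measure_singleton (1 : ℝ))] with x hx1 hx
  rw [uIoc_of_le zero_le_one] at hx
  have h0 : x ≠ 0 := hx.1.ne'
  have h1 : 1 - x ≠ 0 := sub_ne_zero.2 (Ne.symm hx1)
  rw [zpow_neg_one]
  congr 1
  field_simp
  ring

lemma J2_eq_sqrtMoment {s : ℝ} (hs : 0 < s) : J2 s = 1 / 2 * sqrtMoment 0 s := by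
  refine (Iab_natCast_zero_eq_half 2 hs).trans ?_
  unfold sqrtMoment
  congr 2 with x
  rw [zpow_zero, pow_two, pow_two, mul_self_div_self, mul_self_div_self]
  ring

lemma J3_eq_sqrtMoment {s : ℝ} (hs : 0 < s) :
    J3 s = 1 / 2 * sqrtMoment 0 s - sqrtMoment 1 s := by
  refine (Iab_natCast_zero_eq_half 3 hs).trans ?_
  have h (a : ℝ) : a ^ 3 / a = a ^ 2 := by
    rw [pow_succ, pow_two, mul_assoc, mul_div_assoc, mul_self_div_self]
  have hk : sqrtMoment 1 s = 1 / 2 * (2 * sqrtMoment 1 s) := by ring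
  rw [hk, ← mul_sub]
  unfold sqrtMoment
  rw [← intervalIntegral.integral_const_mul (2 : ℝ), ← intervalIntegral.integral_sub
    (intervalIntegrable_zpow_mul_sqrt (by norm_num) hs.le)
    ((intervalIntegrable_zpow_mul_sqrt (by norm_num) hs.le).const_mul _)]
  congr 2 with x
  rw [h, h, zpow_zero, zpow_one]
  ring

/-- Lemma 3.1: the Picard–Fuchs system `J = d/dt((A + tB)J)` for
`J = (J₁, J₂, J₃)ᵀ`, written componentwise. -/
theorem picard_fuchs_system (t : ℝ) (ht : t ∈ Set.Ioo (0 : ℝ) (1 / 64)) :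
    HasDerivAt (fun s : ℝ => (2 / 3) * s * J1 s - (1 / 12) * J2 s + (1 / 12) * J3 s)
      (J1 t) t ∧
    HasDerivAt (fun s : ℝ => ((4 / 7) * s - 1 / 56) * J2 s + (1 / 56) * J3 s)
      (J2 t) t ∧
    HasDerivAt (fun s : ℝ => ((2 / 21) * s - 5 / 504) * J2 s + ((4 / 9) * s + 5 / 504) * J3 s)
      (J3 t) t := by
  have ht0 := ht.1
  have hd1 := hasDerivAt_sqrtMoment_sub (k := -1) (by norm_num) ht0
  have hd2 := hasDerivAt_sqrtMoment_sub (k := 0) (by norm_num) ht0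
  have hd3 := hasDerivAt_sqrtMoment_sub (k := 1) (by norm_num) ht0
  norm_num only at hd1 hd2 hd3
  refine ⟨?_, ?_, ?_⟩
  · refine ((hd1.const_mul (-1 / 12)).congr_of_eventuallyEq ?_).congr_deriv ?_
    · filter_upwards [Ioi_mem_nhds ht0] with s hs
      rw [J1_eq_sqrtMoment hs, J2_eq_sqrtMoment hs, J3_eq_sqrtMoment hs]
      ring
    · rw [J1_eq_sqrtMoment ht0]
      ring
  · refine ((hd2.const_mul (-1 / 12)).congr_of_eventuallyEq ?_).congr_deriv ?_
    · filter_upwards [Ioi_mem_nhds ht0] with s hs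
      rw [J2_eq_sqrtMoment hs, J3_eq_sqrtMoment hs]
      linear_combination 1 / 84 * sqrtMoment_relation_two (le_of_lt hs)
    · rw [J2_eq_sqrtMoment ht0]
      ring
  · refine (((hd2.const_mul (-1 / 12)).add (hd3.const_mul (1 / 6))).congr_of_eventuallyEq
      ?_).congr_deriv ?_
    · filter_upwards [Ioi_mem_nhds ht0] with s hs
      simp only [Pi.add_apply]
      rw [J2_eq_sqrtMoment hs, J3_eq_sqrtMoment hs]
      linear_combination (1 / 84 - 1 / 189) * sqrtMoment_relation_two (le_of_lt hs) -
        1 / 54 * sqrtMoment_relation_three (le_of_lt hs)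
    · rw [J3_eq_sqrtMoment ht0]
      ring
end
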